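/- Let Φ : M_n(ℂ) → M_m(ℂ) be a quantum channel, let ψ be an n×n density matrix, let φ be a positive definite n×n complex matrix such that Φ(φ) is positive definite, and let α ∈ (1, ∞). Then D_α(ψ‖φ) = D_α(Φ(ψ)‖Φ(φ)) if and only if there exists a quantum channel Ψ : M_m(ℂ) → M_n(ℂ) such that Ψ(Φ(ψ)) = ψ and Ψ(Φ(φ)) = φ. (Finite-dimensional form of the α > 1 equality–sufficiency theorem used in the proof of the main theorem.) -/

import Mathlib

open Matrix
open scoped ComplexOrder

/-- Real power of a matrix, defined via the spectral decomposition when the matrix is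
Hermitian (applying the real power function to the eigenvalues), and `0` otherwise. -/
noncomputable def mpow {n : ℕ} (A : Matrix (Fin n) (Fin n) ℂ) (r : ℝ) :
    Matrix (Fin n) (Fin n) ℂ :=
  if hA : A.IsHermitian then
    (hA.eigenvectorUnitary : Matrix (Fin n) (Fin n) ℂ) *
      Matrix.diagonal (fun i => ((hA.eigenvalues i ^ r : ℝ) : ℂ)) *
      (star hA.eigenvectorUnitary : Matrix (Fin n) (Fin n) ℂ)
  else 0

/-- Blockwise application of a linear map on `n × n` matrices to a `k × k` block matrix
with `n × n` blocks. -/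
def blockApply {n m : ℕ} (Φ : Matrix (Fin n) (Fin n) ℂ →ₗ[ℂ] Matrix (Fin m) (Fin m) ℂ)
    (k : ℕ) (M : Matrix (Fin n × Fin k) (Fin n × Fin k) ℂ) :
    Matrix (Fin m × Fin k) (Fin m × Fin k) ℂ :=
  Matrix.of fun p q => Φ (Matrix.of fun i j => M (i, p.2) (j, q.2)) p.1 q.1

/-- A linear map is completely positive if all its blockwise applications preserve
positive semidefiniteness. -/
def IsCompletelyPositive {n m : ℕ}
    (Φ : Matrix (Fin n) (Fin n) ℂ →ₗ[ℂ] Matrix (Fin m) (Fin m) ℂ) : Prop :=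
  ∀ k : ℕ, 1 ≤ k → ∀ M : Matrix (Fin n × Fin k) (Fin n × Fin k) ℂ,
    M.PosSemidef → (blockApply Φ k M).PosSemidef

/-- A quantum channel is a completely positive trace-preserving linear map. -/
def IsQuantumChannel {n m : ℕ}
    (Φ : Matrix (Fin n) (Fin n) ℂ →ₗ[ℂ] Matrix (Fin m) (Fin m) ℂ) : Prop :=
  IsCompletelyPositive Φ ∧ ∀ X : Matrix (Fin n) (Fin n) ℂ, (Φ X).trace = X.trace

/-- The sandwiched Rényi relative entropy
`D_α(ψ‖φ) = (1/(α−1)) · log Tr[(φ^((1−α)/(2α)) ψ φ^((1−α)/(2α)))^α]`. -/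
noncomputable def sandwichedRenyi {n : ℕ} (α : ℝ)
    (ψ φ : Matrix (Fin n) (Fin n) ℂ) : ℝ :=
  (1 / (α - 1)) * Real.log
    ((Matrix.trace (mpow (mpow φ ((1 - α) / (2 * α)) * ψ * mpow φ ((1 - α) / (2 * α))) α)).re)

/-! ### Functions of a Hermitian matrix -/

/-- Apply a complex-valued function to the eigenvalues of a Hermitian matrix. -/
noncomputable def hermFun {n : ℕ} (A : Matrix (Fin n) (Fin n) ℂ) (h : ℝ → ℂ) :
    Matrix (Fin n) (Fin n) ℂ :=
  if hA : A.IsHermitian then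
    (hA.eigenvectorUnitary : Matrix (Fin n) (Fin n) ℂ) *
      Matrix.diagonal (fun i => h (hA.eigenvalues i)) *
      (star hA.eigenvectorUnitary : Matrix (Fin n) (Fin n) ℂ)
  else 0

lemma mpow_eq_hermFun {n : ℕ} (A : Matrix (Fin n) (Fin n) ℂ) (r : ℝ) :
    mpow A r = hermFun A (fun x => ((x ^ r : ℝ) : ℂ)) := rfl

section hermFun

variable {n : ℕ} {A : Matrix (Fin n) (Fin n) ℂ}

lemma hermFun_mul (hA : A.IsHermitian) (h k : ℝ → ℂ) :
    hermFun A h * hermFun A k = hermFun A (fun x => h x * k x) := by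
  simp only [hermFun, dif_pos hA]
  rw [← Matrix.diagonal_mul_diagonal]
  simp only [Matrix.mul_assoc]
  rw [← Matrix.mul_assoc (star (hA.eigenvectorUnitary : Matrix (Fin n) (Fin n) ℂ)),
    Unitary.coe_star_mul_self, Matrix.one_mul]

lemma hermFun_conjTranspose (hA : A.IsHermitian) (h : ℝ → ℂ) :
    (hermFun A h)ᴴ = hermFun A (fun x => star (h x)) := by
  simp only [hermFun, dif_pos hA, Matrix.conjTranspose_mul, Matrix.diagonal_conjTranspose,
    Matrix.star_eq_conjTranspose, Matrix.conjTranspose_conjTranspose, Matrix.mul_assoc]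
  rfl

lemma trace_hermFun (hA : A.IsHermitian) (h : ℝ → ℂ) :
    (hermFun A h).trace = ∑ i, h (hA.eigenvalues i) := by
  simp only [hermFun, dif_pos hA]
  rw [Matrix.trace_mul_cycle, Unitary.coe_star_mul_self, Matrix.one_mul, Matrix.trace_diagonal]

lemma hermFun_congr_of_posSemidef (hA : A.PosSemidef) {h k : ℝ → ℂ}
    (hk : ∀ x, 0 ≤ x → h x = k x) : hermFun A h = hermFun A k := by
  simp only [hermFun, dif_pos hA.1]
  congr 3
  funext i
  exact hk _ (hA.eigenvalues_nonneg i)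

lemma hermFun_congr_of_posDef (hA : A.PosDef) {h k : ℝ → ℂ}
    (hk : ∀ x, 0 < x → h x = k x) : hermFun A h = hermFun A k := by
  simp only [hermFun, dif_pos hA.1]
  congr 3
  funext i
  exact hk _ (hA.eigenvalues_pos i)

lemma hermFun_ofReal (hA : A.IsHermitian) : hermFun A (fun x => (x : ℂ)) = A := by
  simp only [hermFun, dif_pos hA]
  conv_rhs => rw [hA.spectral_theorem, Unitary.conjStarAlgAut_apply]
  rfl

lemma hermFun_one (hA : A.IsHermitian) : hermFun A (fun _ => 1) = 1 := by
  simp only [hermFun, dif_pos hA]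
  rw [Matrix.diagonal_one, Matrix.mul_one]
  exact Unitary.coe_mul_star_self _

end hermFun

/-! ### Positive two by two block matrices -/

section blocks

variable {ι κ : Type*}

lemma Matrix.PosSemidef.fromBlocks_swap {A X X' D : Matrix ι ι ℂ}
    (h : (fromBlocks A X X' D).PosSemidef) : (fromBlocks D X' X A).PosSemidef := by
  have := h.submatrix Sum.swap
  rwa [fromBlocks_submatrix_sum_swap_sum_swap] at this

lemma Matrix.PosSemidef.fromBlocks_offDiag {A X X' D : Matrix ι ι ℂ}
    (h : (fromBlocks A X X' D).PosSemidef) : X' = Xᴴ :=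
  (isHermitian_fromBlocks_iff.1 h.1).2.1.symm

lemma Matrix.PosSemidef.fromBlocks_toBlocks₁₁ {A X X' D : Matrix ι ι ℂ}
    (h : (fromBlocks A X X' D).PosSemidef) : A.PosSemidef :=
  h.submatrix Sum.inl

variable [Fintype ι] [Fintype κ]

lemma Matrix.PosSemidef.fromBlocks_conj {A X X' D : Matrix ι ι ℂ}
    (h : (fromBlocks A X X' D).PosSemidef) (S T : Matrix κ ι ℂ) :
    (fromBlocks (S * A * Sᴴ) (S * X * Tᴴ) (T * X' * Sᴴ) (T * D * Tᴴ)).PosSemidef := by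
  have := h.mul_mul_conjTranspose_same (fromBlocks S 0 0 T)
  simpa [fromBlocks_conjTranspose, fromBlocks_multiply] using this

open scoped MatrixOrder in
lemma Matrix.PosSemidef.trace_mul_nonneg {A B : Matrix ι ι ℂ}
    (hA : A.PosSemidef) (hB : B.PosSemidef) : 0 ≤ (A * B).trace := by
  classical
  obtain ⟨C, hC, -, rfl⟩ :=
    CFC.exists_sqrt_of_isSelfAdjoint_of_quasispectrumRestricts hB.isHermitian
      (QuasispectrumRestricts.nnreal_of_nonneg hB.nonneg)
  have hC' : Cᴴ = C := hC
  rw [← Matrix.mul_assoc, trace_mul_cycle]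
  nth_rewrite 2 [← hC']
  exact (hA.mul_mul_conjTranspose_same C).trace_nonneg

/-- The trace pairing of two positive block matrices bounds the pairing of their corners. -/
lemma Matrix.PosSemidef.two_mul_norm_trace_le {A X X' D A' Z Z' D' : Matrix ι ι ℂ}
    (h : (fromBlocks A X X' D).PosSemidef) (h' : (fromBlocks A' Z Z' D').PosSemidef) :
    2 * ‖(X * Z).trace‖ ≤ ((A * D').trace + (D * A').trace).re := by
  classical
  obtain ⟨c, hc, hcX⟩ : ∃ c : ℂ, ‖c‖ = 1 ∧ c * (X * Z).trace = -(‖(X * Z).trace‖ : ℂ) := by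
    by_cases h0 : (X * Z).trace = 0
    · exact ⟨1, by simp, by simp [h0]⟩
    · refine ⟨-(‖(X * Z).trace‖ : ℂ) / (X * Z).trace, ?_, by field_simp⟩
      simp [h0]
  have hcc : c * star c = 1 := by
    rw [Complex.star_def, Complex.mul_conj, Complex.normSq_eq_norm_sq, hc]; simp
  have h1 := h.fromBlocks_conj (c • (1 : Matrix ι ι ℂ)) 1
  have hX := h.fromBlocks_offDiag
  have hZ := h'.fromBlocks_offDiag
  have h2 := h1.trace_mul_nonneg h'.fromBlocks_swap
  rw [fromBlocks_multiply, trace, Fintype.sum_sum_type] at h2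
  simp only [diag_apply, fromBlocks_apply₁₁, fromBlocks_apply₂₂] at h2
  change 0 ≤ trace _ + trace _ at h2
  have h3 : (X' * Z').trace = star (X * Z).trace := by
    rw [hX, hZ, ← conjTranspose_mul, trace_conjTranspose, trace_mul_comm]
  have h4 : star c * star (X * Z).trace = -(‖(X * Z).trace‖ : ℂ) := by
    rw [← star_mul', hcX]; simp
  simp only [trace_add, conjTranspose_smul, smul_mul, Matrix.mul_smul, trace_smul, conjTranspose_one,
    Matrix.mul_one, Matrix.one_mul, smul_eq_mul] at h2
  rw [← mul_assoc, mul_comm (star c) c, hcc, one_mul, h3, h4, hcX] at h2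
  have := (Complex.le_def.1 h2).1
  simp at this ⊢
  linarith

end blocks

lemma posSemidef_fromBlocks_diagonal {n : ℕ} (h : Fin n → ℂ) (k : Fin n → ℝ)
    (hk : ∀ i, ‖h i‖ ≤ k i) :
    (fromBlocks (diagonal fun i => (k i : ℂ)) (diagonal h) (diagonal fun i => star (h i))
      (diagonal fun i => (k i : ℂ))).PosSemidef := by
  refine PosSemidef.of_dotProduct_mulVec_nonneg ?_ ?_
  · rw [isHermitian_fromBlocks_iff]
    refine ⟨?_, ?_, ?_, ?_⟩ <;> simp [IsHermitian, diagonal_conjTranspose]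
  · intro x
    simp only [dotProduct, Fintype.sum_sum_type, mulVec, fromBlocks_apply₁₁, fromBlocks_apply₁₂,
      fromBlocks_apply₂₁, fromBlocks_apply₂₂, diagonal_apply, ite_mul, zero_mul,
      Finset.sum_ite_eq, Finset.mem_univ, if_true]
    rw [← Finset.sum_add_distrib]
    refine Finset.sum_nonneg fun i _ => ?_
    set a := x (Sum.inl i)
    set b := x (Sum.inr i)
    have key : star a * (k i * a + h i * b) + star b * (star (h i) * a + k i * b)
        = ((k i * ‖a‖ ^ 2 + k i * ‖b‖ ^ 2 + 2 * (star a * (h i * b)).re : ℝ) : ℂ) := by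
      have e1 : star a * a = ((‖a‖ ^ 2 : ℝ) : ℂ) := by
        rw [Complex.star_def, mul_comm, Complex.mul_conj, Complex.normSq_eq_norm_sq]
      have e2 : star b * b = ((‖b‖ ^ 2 : ℝ) : ℂ) := by
        rw [Complex.star_def, mul_comm, Complex.mul_conj, Complex.normSq_eq_norm_sq]
      have e3 : star a * (h i * b) + star b * (star (h i) * a)
          = ((2 * (star a * (h i * b)).re : ℝ) : ℂ) := by
        rw [← Complex.add_conj]
        simp only [map_mul, Complex.star_def, Complex.conj_conj]
        ring
      rw [Complex.ofReal_add, ← e3, Complex.ofReal_add, Complex.ofReal_mul, Complex.ofReal_mul,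
        ← e1, ← e2]
      ring
    simp only [Pi.star_apply]
    rw [key]
    rw [Complex.zero_le_real]
    have h1 : |(star a * (h i * b)).re| ≤ ‖a‖ * (k i * ‖b‖) := by
      refine (Complex.abs_re_le_norm _).trans ?_
      rw [norm_mul, norm_mul, norm_star]
      gcongr
      exact hk i
    have h2 := (abs_le.1 h1).1
    have h3 : 0 ≤ k i := (norm_nonneg _).trans (hk i)
    nlinarith [mul_nonneg h3 (sq_nonneg (‖a‖ - ‖b‖))]

lemma posSemidef_fromBlocks_hermFun {n : ℕ} {A : Matrix (Fin n) (Fin n) ℂ} (hA : A.PosSemidef)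
    (h : ℝ → ℂ) (k : ℝ → ℝ) (hk : ∀ x, 0 ≤ x → ‖h x‖ ≤ k x) :
    (fromBlocks (hermFun A fun x => (k x : ℂ)) (hermFun A h) (hermFun A fun x => star (h x))
      (hermFun A fun x => (k x : ℂ))).PosSemidef := by
  simp only [hermFun, dif_pos hA.1]
  exact (posSemidef_fromBlocks_diagonal (fun i => h (hA.1.eigenvalues i))
    (fun i => k (hA.1.eigenvalues i)) fun i => hk _ (hA.eigenvalues_nonneg i)).fromBlocks_conj
      (hA.1.eigenvectorUnitary : Matrix (Fin n) (Fin n) ℂ) hA.1.eigenvectorUnitary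

/-! ### Complex powers of positive matrices -/

/-- The complex power `x ^ z` of a nonnegative real, with `0 ^ z = 0` for every `z`, so that it is
entire in `z`. -/
noncomputable def suppCpow (z : ℂ) (x : ℝ) : ℂ :=
  if x ≤ 0 then 0 else Complex.exp (z * Real.log x)

lemma suppCpow_of_pos (z : ℂ) {x : ℝ} (hx : 0 < x) :
    suppCpow z x = Complex.exp (z * Real.log x) := if_neg hx.not_ge

lemma suppCpow_mul (z w : ℂ) (x : ℝ) : suppCpow z x * suppCpow w x = suppCpow (z + w) x := by
  unfold suppCpow
  split_ifs
  · simp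
  · rw [← Complex.exp_add, add_mul]

lemma star_suppCpow (z : ℂ) (x : ℝ) : star (suppCpow z x) = suppCpow (star z) x := by
  unfold suppCpow
  split_ifs
  · simp
  · rw [Complex.star_def, ← Complex.exp_conj, map_mul, Complex.conj_ofReal]

lemma suppCpow_ofReal_of_pos (r : ℝ) {x : ℝ} (hx : 0 < x) :
    suppCpow r x = ((x ^ r : ℝ) : ℂ) := by
  rw [suppCpow_of_pos _ hx, Real.rpow_def_of_pos hx, mul_comm]
  push_cast
  rfl

lemma suppCpow_ofReal {r : ℝ} (hr : r ≠ 0) {x : ℝ} (hx : 0 ≤ x) :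
    suppCpow r x = ((x ^ r : ℝ) : ℂ) := by
  rcases hx.eq_or_lt with rfl | hx
  · simp [suppCpow, Real.zero_rpow hr]
  · exact suppCpow_ofReal_of_pos r hx

lemma norm_suppCpow_le (z : ℂ) {x : ℝ} (hx : 0 ≤ x) : ‖suppCpow z x‖ ≤ x ^ z.re := by
  rcases hx.eq_or_lt with rfl | hx
  · simp [suppCpow, Real.zero_rpow_nonneg]
  · rw [suppCpow_of_pos _ hx, Complex.norm_exp, Real.rpow_def_of_pos hx, mul_comm]
    simp

/-- The complex power of a positive semidefinite matrix, vanishing on its kernel. -/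
noncomputable def suppPow {n : ℕ} (A : Matrix (Fin n) (Fin n) ℂ) (z : ℂ) :
    Matrix (Fin n) (Fin n) ℂ :=
  hermFun A (suppCpow z)

section suppPow

variable {n : ℕ} {A : Matrix (Fin n) (Fin n) ℂ}

lemma suppPow_mul (hA : A.IsHermitian) (z w : ℂ) :
    suppPow A z * suppPow A w = suppPow A (z + w) := by
  simp only [suppPow, hermFun_mul hA, suppCpow_mul]

lemma suppPow_mul_assoc (hA : A.IsHermitian) (z w : ℂ) (B : Matrix (Fin n) (Fin n) ℂ) :
    suppPow A z * (suppPow A w * B) = suppPow A (z + w) * B := by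
  rw [← Matrix.mul_assoc, suppPow_mul hA]

lemma suppPow_conjTranspose (hA : A.IsHermitian) (z : ℂ) :
    (suppPow A z)ᴴ = suppPow A (star z) := by
  simp only [suppPow, hermFun_conjTranspose hA, star_suppCpow]

lemma suppPow_zero (hA : A.PosDef) : suppPow A 0 = 1 := by
  rw [← hermFun_one hA.1]
  exact hermFun_congr_of_posDef hA fun x hx => by simp [suppCpow_of_pos _ hx]

lemma suppPow_one (hA : A.PosSemidef) : suppPow A 1 = A := by
  conv_rhs => rw [← hermFun_ofReal hA.1]
  exact hermFun_congr_of_posSemidef hA fun x hx => by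
    simpa using suppCpow_ofReal one_ne_zero hx

lemma mpow_eq_suppPow (hA : A.PosSemidef) {r : ℝ} (hr : r ≠ 0) : mpow A r = suppPow A r := by
  rw [mpow_eq_hermFun, suppPow]
  exact hermFun_congr_of_posSemidef hA fun _ hx => (suppCpow_ofReal hr hx).symm

lemma mpow_eq_suppPow_of_posDef (hA : A.PosDef) (r : ℝ) : mpow A r = suppPow A r := by
  rw [mpow_eq_hermFun, suppPow]
  exact hermFun_congr_of_posDef hA fun _ hx => (suppCpow_ofReal_of_pos r hx).symm

lemma mpow_zero (hA : A.IsHermitian) : mpow A 0 = 1 := by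
  rw [mpow_eq_hermFun, ← hermFun_one hA]
  simp

lemma trace_mpow (hA : A.IsHermitian) (r : ℝ) :
    (mpow A r).trace = ((∑ i, hA.eigenvalues i ^ r : ℝ) : ℂ) := by
  rw [mpow_eq_hermFun, trace_hermFun hA]
  push_cast
  rfl

lemma trace_mpow_re_nonneg (hA : A.PosSemidef) (r : ℝ) : 0 ≤ (mpow A r).trace.re := by
  rw [trace_mpow hA.1, Complex.ofReal_re]
  exact Finset.sum_nonneg fun i _ => Real.rpow_nonneg (hA.eigenvalues_nonneg i) _

lemma trace_mpow_re_pos (hA : A.PosSemidef) (hA0 : A ≠ 0) (r : ℝ) :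
    0 < (mpow A r).trace.re := by
  rw [trace_mpow hA.1, Complex.ofReal_re]
  have : ∃ i, hA.1.eigenvalues i ≠ 0 := by
    by_contra! h
    exact hA0 ((hA.1.eigenvalues_eq_zero_iff).1 (funext h))
  obtain ⟨i, hi⟩ := this
  exact Finset.sum_pos' (fun i _ => Real.rpow_nonneg (hA.eigenvalues_nonneg i) _)
    ⟨i, Finset.mem_univ i, Real.rpow_pos_of_pos ((hA.eigenvalues_nonneg i).lt_of_ne' hi) _⟩

/-- The block matrix with corner `S * A ^ z * S` is positive. -/
lemma posSemidef_fromBlocks_suppPow (hA : A.PosSemidef) (z : ℂ) (S : Matrix (Fin n) (Fin n) ℂ) :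
    (fromBlocks (S * mpow A z.re * Sᴴ) (S * suppPow A z * S)
      (Sᴴ * suppPow A (star z) * Sᴴ) (Sᴴ * mpow A z.re * S)).PosSemidef := by
  have := (posSemidef_fromBlocks_hermFun hA (suppCpow z) (fun x => x ^ z.re)
    fun x hx => norm_suppCpow_le z hx).fromBlocks_conj S Sᴴ
  simp only [conjTranspose_conjTranspose, star_suppCpow] at this
  exact this

end suppPow

/-! ### Entire functions bounded on the unit strip -/

/-- An entire function which is bounded on the strip `0 ≤ re z ≤ 1`. -/
def EntireStripBounded (g : ℂ → ℂ) : Prop :=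
  Differentiable ℂ g ∧ ∃ C, ∀ z : ℂ, 0 ≤ z.re → z.re ≤ 1 → ‖g z‖ ≤ C

namespace EntireStripBounded

lemma const (c : ℂ) : EntireStripBounded fun _ => c :=
  ⟨differentiable_const c, ‖c‖, fun _ _ _ => le_rfl⟩

lemma add {f g : ℂ → ℂ} (hf : EntireStripBounded f) (hg : EntireStripBounded g) :
    EntireStripBounded fun z => f z + g z := by
  obtain ⟨hf, C, hC⟩ := hf
  obtain ⟨hg, D, hD⟩ := hg
  exact ⟨hf.add hg, C + D, fun z h0 h1 => norm_add_le_of_le (hC z h0 h1) (hD z h0 h1)⟩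

lemma mul {f g : ℂ → ℂ} (hf : EntireStripBounded f) (hg : EntireStripBounded g) :
    EntireStripBounded fun z => f z * g z := by
  obtain ⟨hf, C, hC⟩ := hf
  obtain ⟨hg, D, hD⟩ := hg
  refine ⟨hf.mul hg, C * D, fun z h0 h1 => ?_⟩
  rw [norm_mul]
  exact mul_le_mul (hC z h0 h1) (hD z h0 h1) (norm_nonneg _) ((norm_nonneg _).trans (hC z h0 h1))

lemma sum {ι : Type*} (s : Finset ι) {f : ι → ℂ → ℂ} (hf : ∀ i, EntireStripBounded (f i)) :
    EntireStripBounded fun z => ∑ i ∈ s, f i z := by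
  classical
  induction s using Finset.induction_on with
  | empty => simpa using const 0
  | insert i s hi ih => simpa only [Finset.sum_insert hi] using (hf i).add ih

lemma suppCpow (a b x : ℝ) : EntireStripBounded fun z => suppCpow (a * z + b) x := by
  by_cases hx : x ≤ 0
  · simpa only [_root_.suppCpow, if_pos hx] using const 0
  · simp only [_root_.suppCpow, if_neg hx]
    refine ⟨by fun_prop, Real.exp ((|a| + |b|) * |Real.log x|), fun z h0 h1 => ?_⟩
    rw [Complex.norm_exp]
    refine Real.exp_le_exp.2 ?_
    have : ((a * z + b) * (Real.log x : ℂ)).re = (a * z.re + b) * Real.log x := by simp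
    rw [this]
    refine (le_abs_self _).trans ?_
    rw [abs_mul]
    gcongr
    refine (abs_add_le _ _).trans ?_
    rw [abs_mul, abs_of_nonneg h0]
    gcongr
    exact mul_le_of_le_one_right (abs_nonneg _) h1

end EntireStripBounded

/-- A matrix-valued function with entries entire and bounded on the unit strip. -/
def MatrixEntireStripBounded {n m : ℕ} (F : ℂ → Matrix (Fin n) (Fin m) ℂ) : Prop :=
  ∀ i j, EntireStripBounded fun z => F z i j

namespace MatrixEntireStripBounded

variable {n m k : ℕ}

lemma const (M : Matrix (Fin n) (Fin m) ℂ) : MatrixEntireStripBounded fun _ => M :=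
  fun i j => .const (M i j)

lemma mul {F : ℂ → Matrix (Fin n) (Fin m) ℂ} {G : ℂ → Matrix (Fin m) (Fin k) ℂ}
    (hF : MatrixEntireStripBounded F) (hG : MatrixEntireStripBounded G) :
    MatrixEntireStripBounded fun z => F z * G z := by
  intro i j
  simp only [Matrix.mul_apply]
  exact .sum _ fun l => (hF i l).mul (hG l j)

lemma map {F : ℂ → Matrix (Fin n) (Fin n) ℂ} (hF : MatrixEntireStripBounded F)
    (Φ : Matrix (Fin n) (Fin n) ℂ →ₗ[ℂ] Matrix (Fin m) (Fin m) ℂ) :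
    MatrixEntireStripBounded fun z => Φ (F z) := by
  intro i j
  have : ∀ z, Φ (F z) i j = ∑ k, ∑ l, F z k l * Φ (Matrix.single k l 1) i j := by
    intro z
    conv_lhs => rw [Matrix.matrix_eq_sum_single (F z)]
    simp only [map_sum, Matrix.sum_apply]
    refine Finset.sum_congr rfl fun k _ => Finset.sum_congr rfl fun l _ => ?_
    rw [← mul_one (F z k l), ← smul_eq_mul, ← Matrix.smul_single, map_smul]
    simp
  simp only [this]
  exact .sum _ fun k => .sum _ fun l => (hF k l).mul (.const _)

lemma trace {F : ℂ → Matrix (Fin n) (Fin n) ℂ} (hF : MatrixEntireStripBounded F) :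
    EntireStripBounded fun z => (F z).trace :=
  .sum _ fun i => hF i i

lemma suppPow {A : Matrix (Fin n) (Fin n) ℂ} (hA : A.IsHermitian) (a b : ℝ) :
    MatrixEntireStripBounded fun z => suppPow A (a * z + b) := by
  simp only [_root_.suppPow, hermFun, dif_pos hA]
  refine ((const _).mul fun i j => ?_).mul (const _)
  by_cases hij : i = j
  · subst hij
    simpa using EntireStripBounded.suppCpow a b (hA.eigenvalues i)
  · simpa [Matrix.diagonal_apply_ne _ hij] using EntireStripBounded.const 0

end MatrixEntireStripBounded

/-! ### Completely positive maps and channels -/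

section channels

variable {n m k : ℕ}

lemma Matrix.trace_prod {ι κ : Type*} [Fintype ι] [Fintype κ] (M N : Matrix (ι × κ) (ι × κ) ℂ) :
    (M * N).trace = ∑ a, ∑ b, ((Matrix.of fun i j => M (i, a) (j, b)) *
      (Matrix.of fun i j => N (i, b) (j, a))).trace := by
  simp only [Matrix.trace, Matrix.diag_apply, Matrix.mul_apply, Fintype.sum_prod_type,
    Matrix.of_apply]
  rw [Finset.sum_comm]
  refine Finset.sum_congr rfl fun a _ => ?_
  conv_rhs => rw [Finset.sum_comm]
  refine Finset.sum_congr rfl fun i _ => ?_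
  rw [Finset.sum_comm]

lemma of_blockApply (Φ : Matrix (Fin n) (Fin n) ℂ →ₗ[ℂ] Matrix (Fin m) (Fin m) ℂ)
    (M : Matrix (Fin n × Fin k) (Fin n × Fin k) ℂ) (a b : Fin k) :
    (Matrix.of fun i j => blockApply Φ k M (i, a) (j, b)) =
      Φ (Matrix.of fun i j => M (i, a) (j, b)) := rfl

lemma IsCompletelyPositive.fromBlocks
    {Φ : Matrix (Fin n) (Fin n) ℂ →ₗ[ℂ] Matrix (Fin m) (Fin m) ℂ} (hΦ : IsCompletelyPositive Φ)
    {A X X' D : Matrix (Fin n) (Fin n) ℂ} (h : (Matrix.fromBlocks A X X' D).PosSemidef) :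
    (Matrix.fromBlocks (Φ A) (Φ X) (Φ X') (Φ D)).PosSemidef := by
  let e : Fin n × Fin 2 → Fin n ⊕ Fin n := fun p => if p.2 = 0 then Sum.inl p.1 else Sum.inr p.1
  let f : Fin m ⊕ Fin m → Fin m × Fin 2 := Sum.elim (fun i => (i, 0)) (fun i => (i, 1))
  have h1 := (hΦ 2 one_le_two _ (h.submatrix e)).submatrix f
  convert h1 using 1
  ext (i | i) (j | j) <;> rfl

lemma IsCompletelyPositive.posSemidef
    {Φ : Matrix (Fin n) (Fin n) ℂ →ₗ[ℂ] Matrix (Fin m) (Fin m) ℂ} (hΦ : IsCompletelyPositive Φ)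
    {A : Matrix (Fin n) (Fin n) ℂ} (h : A.PosSemidef) : (Φ A).PosSemidef :=
  ((hΦ 1 le_rfl _ (h.submatrix Prod.fst)).submatrix fun i => (i, 0))

lemma IsCompletelyPositive.comp
    {Ψ : Matrix (Fin m) (Fin m) ℂ →ₗ[ℂ] Matrix (Fin k) (Fin k) ℂ}
    {Φ : Matrix (Fin n) (Fin n) ℂ →ₗ[ℂ] Matrix (Fin m) (Fin m) ℂ}
    (hΨ : IsCompletelyPositive Ψ) (hΦ : IsCompletelyPositive Φ) :
    IsCompletelyPositive (Ψ ∘ₗ Φ) :=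
  fun l hl M hM => hΨ l hl _ (hΦ l hl M hM)

/-- The map `X ↦ K * X * Kᴴ`. -/
noncomputable def conjMap (K : Matrix (Fin m) (Fin n) ℂ) :
    Matrix (Fin n) (Fin n) ℂ →ₗ[ℂ] Matrix (Fin m) (Fin m) ℂ where
  toFun X := K * X * Kᴴ
  map_add' X Y := by rw [Matrix.mul_add, Matrix.add_mul]
  map_smul' c X := by simp

lemma isCompletelyPositive_conjMap (K : Matrix (Fin m) (Fin n) ℂ) :
    IsCompletelyPositive (conjMap K) := by
  intro l _ M hM
  have := hM.mul_mul_conjTranspose_same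
    (Matrix.of fun (p : Fin m × Fin l) (q : Fin n × Fin l) => if p.2 = q.2 then K p.1 q.1 else 0)
  convert this using 1
  ext ⟨i, a⟩ ⟨j, b⟩
  simp [blockApply, conjMap, Matrix.mul_apply, Fintype.sum_prod_type, apply_ite, ite_mul]

/-- The adjoint of a linear map on matrices for the trace pairing. -/
noncomputable def traceAdjoint (Φ : Matrix (Fin n) (Fin n) ℂ →ₗ[ℂ] Matrix (Fin m) (Fin m) ℂ) :
    Matrix (Fin m) (Fin m) ℂ →ₗ[ℂ] Matrix (Fin n) (Fin n) ℂ where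
  toFun Z := Matrix.of fun i j => (Z * Φ (Matrix.single j i 1)).trace
  map_add' X Y := by ext i j; simp [Matrix.add_mul]
  map_smul' c X := by ext i j; simp

lemma trace_traceAdjoint_mul (Φ : Matrix (Fin n) (Fin n) ℂ →ₗ[ℂ] Matrix (Fin m) (Fin m) ℂ)
    (Z : Matrix (Fin m) (Fin m) ℂ) (X : Matrix (Fin n) (Fin n) ℂ) :
    (traceAdjoint Φ Z * X).trace = (Z * Φ X).trace := by
  conv_rhs => rw [Matrix.matrix_eq_sum_single X]
  simp only [map_sum, Matrix.mul_sum, Matrix.trace_sum]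
  rw [Matrix.trace, Finset.sum_comm]
  simp only [Matrix.diag_apply, Matrix.mul_apply]
  refine Finset.sum_congr rfl fun i _ => Finset.sum_congr rfl fun j _ => ?_
  have : Φ (Matrix.single j i (X j i)) = X j i • Φ (Matrix.single j i 1) := by
    rw [← map_smul, Matrix.smul_single, smul_eq_mul, mul_one]
  rw [this, Matrix.mul_smul, Matrix.trace_smul, smul_eq_mul, mul_comm]
  rfl

lemma Matrix.PosSemidef.of_forall_trace_mul_nonneg {ι : Type*} [Fintype ι] {M : Matrix ι ι ℂ}
    (h : ∀ N : Matrix ι ι ℂ, N.PosSemidef → 0 ≤ (M * N).trace) : M.PosSemidef := by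
  classical
  have h1 : ∀ x : ι → ℂ, 0 ≤ star x ⬝ᵥ M *ᵥ x := fun x => by
    have := h _ (Matrix.posSemidef_vecMulVec_self_star x)
    rwa [Matrix.mul_vecMulVec, Matrix.trace_vecMulVec, dotProduct_comm] at this
  refine .of_dotProduct_mulVec_nonneg ?_ h1
  rw [← Matrix.isSymmetric_toEuclideanLin_iff, LinearMap.isSymmetric_iff_inner_map_self_real]
  intro v
  have h2 := Complex.conj_eq_iff_im.2 (Complex.le_def.1 (h1 v.ofLp)).2.symm
  rw [← inner_conj_symm, Complex.conj_conj]
  simpa [EuclideanSpace.inner_eq_star_dotProduct, dotProduct_comm] using h2.symm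

lemma isCompletelyPositive_traceAdjoint
    {Φ : Matrix (Fin n) (Fin n) ℂ →ₗ[ℂ] Matrix (Fin m) (Fin m) ℂ}
    (hΦ : IsCompletelyPositive Φ) : IsCompletelyPositive (traceAdjoint Φ) := by
  intro l hl M hM
  refine .of_forall_trace_mul_nonneg fun N hN => ?_
  have h1 := hM.trace_mul_nonneg (hΦ l hl N hN)
  rw [Matrix.trace_prod] at h1 ⊢
  simpa only [of_blockApply, trace_traceAdjoint_mul] using h1

lemma traceAdjoint_one {Φ : Matrix (Fin n) (Fin n) ℂ →ₗ[ℂ] Matrix (Fin m) (Fin m) ℂ}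
    (hΦ : IsQuantumChannel Φ) : traceAdjoint Φ 1 = 1 := by
  ext i j
  change (1 * Φ (Matrix.single j i 1)).trace = _
  rw [Matrix.one_mul, hΦ.2]
  by_cases hij : i = j
  · subst hij
    simp
  · rw [Matrix.trace_single_eq_of_ne _ _ _ (Ne.symm hij), Matrix.one_apply_ne hij]

end channels

/-! ### Interpolation between the reference states -/

section interpolation

variable {n m : ℕ}

/-- The analytic family `σ ^ ((1 - z) / 2) * Y ^ (p * z) * σ ^ ((1 - z) / 2)`. -/
noncomputable def interpPath (σ Y : Matrix (Fin n) (Fin n) ℂ) (p : ℝ) (z : ℂ) :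
    Matrix (Fin n) (Fin n) ℂ :=
  suppPow σ ((1 - z) / 2) * suppPow Y (p * z) * suppPow σ ((1 - z) / 2)

/-- The analytic family `τ ^ (-(1 - z) / 2) * W ^ (p * (1 - z)) * τ ^ (-(1 - z) / 2)`, dual to
`interpPath`. -/
noncomputable def dualPath (τ W : Matrix (Fin n) (Fin n) ℂ) (p : ℝ) (z : ℂ) :
    Matrix (Fin n) (Fin n) ℂ :=
  suppPow τ (-(1 - z) / 2) * suppPow W (p * (1 - z)) * suppPow τ (-(1 - z) / 2)

lemma matrixEntireStripBounded_interpPath {σ Y : Matrix (Fin n) (Fin n) ℂ} (hσ : σ.IsHermitian)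
    (hY : Y.IsHermitian) (p : ℝ) : MatrixEntireStripBounded (interpPath σ Y p) := by
  have h1 := MatrixEntireStripBounded.suppPow hσ (-1 / 2) (1 / 2)
  have h2 := MatrixEntireStripBounded.suppPow hY p 0
  convert (h1.mul h2).mul h1 using 2 with z
  simp only [interpPath]
  push_cast
  congr 3 <;> ring_nf

lemma matrixEntireStripBounded_dualPath {τ W : Matrix (Fin n) (Fin n) ℂ} (hτ : τ.IsHermitian)
    (hW : W.IsHermitian) (p : ℝ) : MatrixEntireStripBounded (dualPath τ W p) := by
  have h1 := MatrixEntireStripBounded.suppPow hτ (1 / 2) (-1 / 2)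
  have h2 := MatrixEntireStripBounded.suppPow hW (-p) p
  convert (h1.mul h2).mul h1 using 2 with z
  simp only [dualPath]
  push_cast
  congr 3 <;> ring_nf

lemma one_sub_div_two_add_star (z : ℂ) :
    (1 - z) / 2 + star ((1 - z) / 2) = ((1 - z.re : ℝ) : ℂ) := by
  apply Complex.ext
  · simp
  · simp
    ring

lemma neg_one_sub_div_two_add_star (z : ℂ) :
    -(1 - z) / 2 + star (-(1 - z) / 2) = -((1 - z.re : ℝ) : ℂ) := by
  rw [← one_sub_div_two_add_star, neg_div, star_neg]
  ring

lemma trace_sandwich_mul_of_mul_eq_one {S S' K τ : Matrix (Fin n) (Fin n) ℂ}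
    (h : S' * τ * S = 1) : (τ * (S * K * S')).trace = K.trace := by
  rw [← Matrix.mul_assoc, Matrix.trace_mul_comm, ← Matrix.mul_assoc, ← Matrix.mul_assoc, h,
    Matrix.one_mul]

variable {Φ : Matrix (Fin n) (Fin n) ℂ →ₗ[ℂ] Matrix (Fin m) (Fin m) ℂ}
  {σ Y : Matrix (Fin n) (Fin n) ℂ} {W : Matrix (Fin m) (Fin m) ℂ}

lemma two_mul_norm_trace_interpPath_mul_dualPath_le (hΦ : IsQuantumChannel Φ) (hσ : σ.PosDef)
    (hτ : (Φ σ).PosDef) (hY : Y.PosSemidef) (hW : W.PosSemidef) (p : ℝ) (z : ℂ) :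
    2 * ‖(Φ (interpPath σ Y p z) * dualPath (Φ σ) W p z).trace‖ ≤
      ((Φ (suppPow σ ((1 - z) / 2) * mpow Y (p * z.re) * suppPow σ (star ((1 - z) / 2))) *
        (suppPow (Φ σ) (star (-(1 - z) / 2)) * mpow W (p * (1 - z.re)) *
          suppPow (Φ σ) (-(1 - z) / 2))).trace +
      (Φ (suppPow σ (star ((1 - z) / 2)) * mpow Y (p * z.re) * suppPow σ ((1 - z) / 2)) *
        (suppPow (Φ σ) (-(1 - z) / 2) * mpow W (p * (1 - z.re)) *
          suppPow (Φ σ) (star (-(1 - z) / 2)))).trace).re := by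
  have h1 := hΦ.1.fromBlocks
    (posSemidef_fromBlocks_suppPow hY (p * z) (suppPow σ ((1 - z) / 2)))
  have h2 := posSemidef_fromBlocks_suppPow hW (p * (1 - z)) (suppPow (Φ σ) (-(1 - z) / 2))
  have h3 := h1.two_mul_norm_trace_le h2
  rw [suppPow_conjTranspose hσ.1, suppPow_conjTranspose hτ.1, Complex.re_ofReal_mul,
    Complex.re_ofReal_mul, Complex.sub_re, Complex.one_re] at h3
  exact h3

lemma norm_trace_interpPath_mul_dualPath_le_left (hΦ : IsQuantumChannel Φ) (hσ : σ.PosDef)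
    (hτ : (Φ σ).PosDef) (hY : Y.PosSemidef) (hW : W.PosSemidef) (p : ℝ) {z : ℂ} (hz : z.re = 0) :
    ‖(Φ (interpPath σ Y p z) * dualPath (Φ σ) W p z).trace‖ ≤ (mpow W p).trace.re := by
  have h := two_mul_norm_trace_interpPath_mul_dualPath_le hΦ hσ hτ hY hW p z
  have e1 : (1 - z) / 2 + star ((1 - z) / 2) = 1 := by
    rw [one_sub_div_two_add_star, hz]
    simp
  have e2 : -(1 - z) / 2 + (1 + star (-(1 - z) / 2)) = 0 := by
    rw [add_left_comm, neg_one_sub_div_two_add_star, hz]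
    simp
  have e3 : star (-(1 - z) / 2) + (1 + -(1 - z) / 2) = 0 := by linear_combination e2
  rw [hz, mul_zero, mpow_zero hY.1, Matrix.mul_one, Matrix.mul_one, suppPow_mul hσ.1,
    suppPow_mul hσ.1, e1, add_comm (star _), e1, suppPow_one hσ.posSemidef, sub_zero, mul_one,
    trace_sandwich_mul_of_mul_eq_one, trace_sandwich_mul_of_mul_eq_one, Complex.add_re] at h
  · linarith
  · nth_rewrite 2 [← suppPow_one hτ.posSemidef]
    rw [Matrix.mul_assoc, suppPow_mul hτ.1, suppPow_mul hτ.1, e3, suppPow_zero hτ]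
  · nth_rewrite 2 [← suppPow_one hτ.posSemidef]
    rw [Matrix.mul_assoc, suppPow_mul hτ.1, suppPow_mul hτ.1, e2, suppPow_zero hτ]

lemma norm_trace_interpPath_mul_dualPath_le_right (hΦ : IsQuantumChannel Φ) (hσ : σ.PosDef)
    (hτ : (Φ σ).PosDef) (hY : Y.PosSemidef) (hW : W.PosSemidef) (p : ℝ) {z : ℂ} (hz : z.re = 1) :
    ‖(Φ (interpPath σ Y p z) * dualPath (Φ σ) W p z).trace‖ ≤ (mpow Y p).trace.re := by
  have h := two_mul_norm_trace_interpPath_mul_dualPath_le hΦ hσ hτ hY hW p z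
  have e1 : (1 - z) / 2 + star ((1 - z) / 2) = 0 := by
    rw [one_sub_div_two_add_star, hz]
    simp
  have e2 : -(1 - z) / 2 + star (-(1 - z) / 2) = 0 := by
    rw [neg_one_sub_div_two_add_star, hz]
    simp
  rw [hz, mul_one, sub_self, mul_zero, mpow_zero hW.1, Matrix.mul_one, Matrix.mul_one,
    suppPow_mul hτ.1, suppPow_mul hτ.1, e2, add_comm (star _), e2, suppPow_zero hτ,
    Matrix.mul_one, Matrix.mul_one, hΦ.2, hΦ.2, Matrix.trace_mul_cycle _ (mpow Y p),
    Matrix.trace_mul_cycle (suppPow σ (star ((1 - z) / 2))) (mpow Y p),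
    suppPow_mul hσ.1, add_comm (star _), e1, suppPow_mul hσ.1, e1, suppPow_zero hσ,
    Matrix.one_mul, Complex.add_re] at h
  linarith

/-- The operator whose Schatten norm defines the sandwiched Rényi relative entropy. -/
noncomputable def sandwich (p : ℝ) (σ ρ : Matrix (Fin n) (Fin n) ℂ) : Matrix (Fin n) (Fin n) ℂ :=
  mpow σ ((1 - p) / (2 * p)) * ρ * mpow σ ((1 - p) / (2 * p))

lemma sandwich_eq {ρ : Matrix (Fin n) (Fin n) ℂ} (hσ : σ.PosDef) (p : ℝ) :
    sandwich p σ ρ =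
      suppPow σ ((1 - p) / (2 * p) : ℝ) * ρ * suppPow σ ((1 - p) / (2 * p) : ℝ) := by
  rw [sandwich, mpow_eq_suppPow_of_posDef hσ]

lemma posSemidef_sandwich {ρ : Matrix (Fin n) (Fin n) ℂ} (hσ : σ.PosDef) (hρ : ρ.PosSemidef)
    (p : ℝ) : (sandwich p σ ρ).PosSemidef := by
  have := hρ.mul_mul_conjTranspose_same (suppPow σ ((1 - p) / (2 * p) : ℝ))
  rwa [suppPow_conjTranspose hσ.1, Complex.star_def, Complex.conj_ofReal, ← sandwich_eq hσ] at this

lemma interpPath_sandwich {ρ : Matrix (Fin n) (Fin n) ℂ} (hσ : σ.PosDef) (hρ : ρ.PosSemidef)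
    {p : ℝ} (hp : 1 < p) : interpPath σ (sandwich p σ ρ) p (1 / p) = ρ := by
  have hp0 : (p : ℂ) ≠ 0 := by exact_mod_cast (by linarith : p ≠ 0)
  rw [interpPath, mul_one_div_cancel hp0, suppPow_one (posSemidef_sandwich hσ hρ p),
    sandwich_eq hσ]
  simp only [Matrix.mul_assoc]
  rw [suppPow_mul hσ.1, suppPow_mul_assoc hσ.1]
  have e : (1 - 1 / (p : ℂ)) / 2 + ((1 - p) / (2 * p) : ℝ) = 0 := by
    push_cast
    field_simp
    ring
  rw [add_comm ((((1 - p) / (2 * p) : ℝ)) : ℂ), e, suppPow_zero hσ, Matrix.one_mul, Matrix.mul_one]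

lemma trace_mul_dualPath_sandwich {ρ : Matrix (Fin n) (Fin n) ℂ} (hσ : σ.PosDef)
    (hρ : ρ.PosSemidef) {p : ℝ} (hp : 1 < p) :
    (ρ * dualPath σ (sandwich p σ ρ) p (1 / p)).trace = (mpow (sandwich p σ ρ) p).trace := by
  have hp0 : (p : ℂ) ≠ 0 := by exact_mod_cast (by linarith : p ≠ 0)
  have hY := posSemidef_sandwich hσ hρ p
  have e : -(1 - 1 / (p : ℂ)) / 2 = ((1 - p) / (2 * p) : ℝ) := by
    push_cast
    field_simp
    ring
  have e' : 1 + (p : ℂ) * (1 - 1 / p) = p := by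
    field_simp
    ring
  rw [dualPath, e, ← Matrix.mul_assoc, Matrix.trace_mul_comm, ← Matrix.mul_assoc,
    ← Matrix.mul_assoc, ← sandwich_eq hσ]
  nth_rewrite 1 [← suppPow_one hY]
  rw [suppPow_mul hY.1, e', mpow_eq_suppPow hY (by linarith)]

lemma trace_interpPath_mul_dualPath_at {ρ : Matrix (Fin n) (Fin n) ℂ}
    (hΦ : IsQuantumChannel Φ) (hσ : σ.PosDef)
    (hτ : (Φ σ).PosDef) (hρ : ρ.PosSemidef) {p : ℝ} (hp : 1 < p) :
    (Φ (interpPath σ (sandwich p σ ρ) p (1 / p)) *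
      dualPath (Φ σ) (sandwich p (Φ σ) (Φ ρ)) p (1 / p)).trace =
      (mpow (sandwich p (Φ σ) (Φ ρ)) p).trace := by
  rw [interpPath_sandwich hσ hρ hp, trace_mul_dualPath_sandwich hτ (hΦ.1.posSemidef hρ) hp]

lemma norm_trace_interpPath_mul_dualPath_le (hΦ : IsQuantumChannel Φ) (hσ : σ.PosDef)
    (hτ : (Φ σ).PosDef) (hY : Y.PosSemidef) (hW : W.PosSemidef) (p : ℝ) {z : ℂ}
    (hz0 : 0 ≤ z.re) (hz1 : z.re ≤ 1) :
    ‖(Φ (interpPath σ Y p z) * dualPath (Φ σ) W p z).trace‖ ≤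
      (mpow W p).trace.re ^ (1 - z.re) * (mpow Y p).trace.re ^ z.re := by
  obtain ⟨hd, C, hC⟩ := (((matrixEntireStripBounded_interpPath hσ.1 hY.1 p).map Φ).mul
    (matrixEntireStripBounded_dualPath hτ.1 hW.1 p)).trace
  refine Complex.HadamardThreeLines.norm_le_interp_of_mem_verticalClosedStrip₀₁'
    (fun z => (Φ (interpPath σ Y p z) * dualPath (Φ σ) W p z).trace) ⟨hz0, hz1⟩ hd.diffContOnCl
    ⟨C, ?_⟩ (fun w hw => norm_trace_interpPath_mul_dualPath_le_left hΦ hσ hτ hY hW p hw)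
    (fun w hw => norm_trace_interpPath_mul_dualPath_le_right hΦ hσ hτ hY hW p hw)
  rintro _ ⟨w, ⟨h0, h1⟩, rfl⟩
  exact hC w h0 h1

/-- Data processing for the trace functional of the sandwiched Rényi relative entropy. -/
lemma trace_mpow_sandwich_le {ρ : Matrix (Fin n) (Fin n) ℂ} (hΦ : IsQuantumChannel Φ)
    (hσ : σ.PosDef) (hτ : (Φ σ).PosDef) (hρ : ρ.PosSemidef) {p : ℝ} (hp : 1 < p) :
    (mpow (sandwich p (Φ σ) (Φ ρ)) p).trace.re ≤ (mpow (sandwich p σ ρ) p).trace.re := by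
  have hY := posSemidef_sandwich hσ hρ p
  have hW := posSemidef_sandwich hτ (hΦ.1.posSemidef hρ) p
  have hp0 : 0 < p := by linarith
  have hre : (1 / (p : ℂ)).re = 1 / p := by
    rw [← Complex.ofReal_one, ← Complex.ofReal_div, Complex.ofReal_re]
  have h := norm_trace_interpPath_mul_dualPath_le hΦ hσ hτ hY hW p (z := 1 / p)
    (by rw [hre]; positivity) (by rw [hre, div_le_one hp0]; exact hp.le)
  rw [trace_interpPath_mul_dualPath_at hΦ hσ hτ hρ hp, hre] at h
  have h1 := (Complex.re_le_norm _).trans h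
  set a := (mpow (sandwich p (Φ σ) (Φ ρ)) p).trace.re
  set b := (mpow (sandwich p σ ρ) p).trace.re
  have ha : 0 ≤ a := trace_mpow_re_nonneg hW p
  have hb : 0 ≤ b := trace_mpow_re_nonneg hY p
  rcases ha.eq_or_lt with ha | ha
  · rwa [← ha]
  · have h2 : a = a ^ (1 - 1 / p) * a ^ (1 / p) := by
      rw [← Real.rpow_add ha]; simp
    have h3 : a ^ (1 - 1 / p) * a ^ (1 / p) ≤ a ^ (1 - 1 / p) * b ^ (1 / p) := h2 ▸ h1
    have h4 := le_of_mul_le_mul_left h3 (Real.rpow_pos_of_pos ha _)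
    exact (Real.rpow_le_rpow_iff ha.le hb (by positivity)).1 h4

/-- In the case of equality in the data processing inequality, the pairing is constant. -/
lemma trace_interpPath_mul_dualPath_eq {ρ : Matrix (Fin n) (Fin n) ℂ} (hΦ : IsQuantumChannel Φ)
    (hσ : σ.PosDef) (hτ : (Φ σ).PosDef) (hρ : ρ.PosSemidef) {p : ℝ} (hp : 1 < p)
    (heq : (mpow (sandwich p σ ρ) p).trace.re = (mpow (sandwich p (Φ σ) (Φ ρ)) p).trace.re)
    {z : ℂ} (hz0 : 0 < z.re) (hz1 : z.re < 1) :
    (Φ (interpPath σ (sandwich p σ ρ) p z) *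
      dualPath (Φ σ) (sandwich p (Φ σ) (Φ ρ)) p z).trace =
      (mpow (sandwich p (Φ σ) (Φ ρ)) p).trace := by
  have hY := posSemidef_sandwich hσ hρ p
  have hW := posSemidef_sandwich hτ (hΦ.1.posSemidef hρ) p
  have hp0 : 0 < p := by linarith
  have hre : (1 / (p : ℂ)).re = 1 / p := by
    rw [← Complex.ofReal_one, ← Complex.ofReal_div, Complex.ofReal_re]
  obtain ⟨hd, -⟩ := (((matrixEntireStripBounded_interpPath hσ.1 hY.1 p).map Φ).mul
    (matrixEntireStripBounded_dualPath hτ.1 hW.1 p)).trace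
  have hconv : Convex ℝ (Complex.re ⁻¹' Set.Ioo (0 : ℝ) 1) :=
    (convex_Ioo 0 1).linear_preimage Complex.reLm
  have hopen : IsOpen (Complex.re ⁻¹' Set.Ioo (0 : ℝ) 1) :=
    isOpen_Ioo.preimage Complex.continuous_re
  have hmem : (1 / (p : ℂ)) ∈ Complex.re ⁻¹' Set.Ioo (0 : ℝ) 1 := by
    rw [Set.mem_preimage, hre]
    exact ⟨by positivity, (div_lt_one hp0).2 hp⟩
  have hat := trace_interpPath_mul_dualPath_at hΦ hσ hτ hρ hp
  have h := Complex.eqOn_of_isPreconnected_of_isMaxOn_norm hconv.isPreconnected hopen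
    hd.differentiableOn hmem ?_ (show z ∈ _ from ⟨hz0, hz1⟩)
  · exact h.trans hat
  · intro w hw
    have h1 := norm_trace_interpPath_mul_dualPath_le hΦ hσ hτ hY hW p hw.1.le hw.2.le
    have ha := trace_mpow_re_nonneg hW p
    rw [heq, ← Real.rpow_add' ha (by simp), sub_add_cancel, Real.rpow_one] at h1
    refine h1.trans ?_
    simp only [Function.comp_apply]
    rw [hat]
    exact Complex.re_le_norm _

end interpolation

/-! ### The weighted Hilbert–Schmidt inner product and the Petz map -/

section petz

variable {n m : ℕ}

lemma isQuantumChannel_id :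
    IsQuantumChannel (LinearMap.id : Matrix (Fin n) (Fin n) ℂ →ₗ[ℂ] Matrix (Fin n) (Fin n) ℂ) :=
  ⟨fun _ _ _ hM => hM, fun _ => rfl⟩

lemma mpow_two {A : Matrix (Fin n) (Fin n) ℂ} (hA : A.PosSemidef) : mpow A 2 = A * A := by
  rw [mpow_eq_suppPow hA two_ne_zero]
  conv_rhs => rw [← suppPow_one hA]
  rw [suppPow_mul hA.1]
  norm_num

lemma Matrix.eq_of_trace_mul_conjTranspose {A B : Matrix (Fin n) (Fin n) ℂ} {c : ℝ}
    (hA : (A * Aᴴ).trace.re ≤ c) (hB : (B * Bᴴ).trace.re ≤ c) (hAB : (A * Bᴴ).trace.re = c) :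
    A = B := by
  have hBA : (B * Aᴴ).trace.re = c := by
    rw [← hAB, ← Complex.conj_re, ← Complex.star_def, ← Matrix.trace_conjTranspose,
      Matrix.conjTranspose_mul, Matrix.conjTranspose_conjTranspose]
  have h0 := Complex.le_def.1 (Matrix.posSemidef_self_mul_conjTranspose (A - B)).trace_nonneg
  have h1 : ((A - B) * (A - B)ᴴ).trace.re ≤ 0 := by
    rw [Matrix.conjTranspose_sub, Matrix.sub_mul, Matrix.mul_sub, Matrix.mul_sub]
    simp only [Matrix.trace_sub, Complex.sub_re]
    linarith
  refine sub_eq_zero.1 (Matrix.trace_mul_conjTranspose_self_eq_zero_iff.1 ?_)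
  exact Complex.ext (le_antisymm h1 h0.1) h0.2.symm

variable {Φ : Matrix (Fin n) (Fin n) ℂ →ₗ[ℂ] Matrix (Fin m) (Fin m) ℂ}
  {σ Y : Matrix (Fin n) (Fin n) ℂ}

lemma sandwich_two (hσ : σ.PosDef) (X : Matrix (Fin n) (Fin n) ℂ) :
    sandwich 2 σ X = suppPow σ (-1 / 4) * X * suppPow σ (-1 / 4) := by
  rw [sandwich_eq hσ]
  norm_num

lemma star_neg_one_div_four : star (-1 / 4 : ℂ) = -1 / 4 := by simp

lemma sandwich_two_conjTranspose (hσ : σ.PosDef) (X : Matrix (Fin n) (Fin n) ℂ) :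
    (sandwich 2 σ X)ᴴ = sandwich 2 σ Xᴴ := by
  rw [sandwich_two hσ, sandwich_two hσ, Matrix.conjTranspose_mul, Matrix.conjTranspose_mul,
    suppPow_conjTranspose hσ.1, star_neg_one_div_four, Matrix.mul_assoc]

lemma sandwich_two_injective (hσ : σ.PosDef) : Function.Injective (sandwich 2 σ) := by
  refine Function.LeftInverse.injective
    (g := fun X => suppPow σ (1 / 4) * X * suppPow σ (1 / 4)) fun X => ?_
  simp only [sandwich_two hσ, Matrix.mul_assoc]
  rw [suppPow_mul hσ.1, suppPow_mul_assoc hσ.1]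
  norm_num [suppPow_zero hσ]

lemma trace_sandwich_two_mul (hσ : σ.PosDef) (X Z : Matrix (Fin n) (Fin n) ℂ) :
    (sandwich 2 σ X * sandwich 2 σ Z).trace =
      (X * (suppPow σ (-1 / 2) * Z * suppPow σ (-1 / 2))).trace := by
  have e : (-1 / 4 : ℂ) + -1 / 4 = -1 / 2 := by norm_num
  rw [sandwich_two hσ, sandwich_two hσ]
  simp only [Matrix.mul_assoc]
  rw [suppPow_mul_assoc hσ.1, e, Matrix.trace_mul_comm]
  simp only [Matrix.mul_assoc]
  rw [suppPow_mul hσ.1, e]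

lemma trace_sandwich_two_sq (hσ : σ.PosDef) (M : Matrix (Fin n) (Fin n) ℂ) {w : ℂ} {w' : ℂ}
    (hw : w + w' = 1 / 2) :
    (sandwich 2 σ (suppPow σ w * M * suppPow σ w') *
      sandwich 2 σ (suppPow σ w * M * suppPow σ w')).trace = (M * M).trace := by
  have e : w' + -1 / 2 + w = 0 := by linear_combination hw
  rw [trace_sandwich_two_mul hσ]
  simp only [Matrix.mul_assoc]
  rw [suppPow_mul hσ.1, suppPow_mul_assoc hσ.1, suppPow_mul_assoc hσ.1, e, suppPow_zero hσ,
    Matrix.one_mul, Matrix.trace_mul_comm]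
  simp only [Matrix.mul_assoc]
  rw [suppPow_mul hσ.1, e, suppPow_zero hσ, Matrix.mul_one]

lemma trace_sandwich_two_map_sq_le {A : Matrix (Fin n) (Fin n) ℂ} (hΦ : IsQuantumChannel Φ)
    (hσ : σ.PosDef) (hτ : (Φ σ).PosDef) (hA : A.PosSemidef) :
    (sandwich 2 (Φ σ) (Φ A) * sandwich 2 (Φ σ) (Φ A)).trace.re ≤
      (sandwich 2 σ A * sandwich 2 σ A).trace.re := by
  have h := trace_mpow_sandwich_le hΦ hσ hτ hA one_lt_two
  rwa [mpow_two (posSemidef_sandwich hσ hA 2),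
    mpow_two (posSemidef_sandwich hτ (hΦ.1.posSemidef hA) 2)] at h

lemma posSemidef_fromBlocks_map_interpPath (hΦ : IsQuantumChannel Φ) (hσ : σ.PosDef)
    (hY : Y.PosSemidef) (p : ℝ) (z : ℂ) :
    (Matrix.fromBlocks
      (Φ (suppPow σ ((1 - z) / 2) * mpow Y (p * z.re) * suppPow σ (star ((1 - z) / 2))))
      (Φ (interpPath σ Y p z)) (Φ (interpPath σ Y p z)ᴴ)
      (Φ (suppPow σ (star ((1 - z) / 2)) * mpow Y (p * z.re) *
        suppPow σ ((1 - z) / 2)))).PosSemidef := by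
  have h := posSemidef_fromBlocks_suppPow hY (p * z) (suppPow σ ((1 - z) / 2))
  rw [h.fromBlocks_offDiag, suppPow_conjTranspose hσ.1, Complex.re_ofReal_mul] at h
  exact hΦ.1.fromBlocks h

lemma map_interpPath_conjTranspose (hΦ : IsQuantumChannel Φ) (hσ : σ.PosDef)
    (hY : Y.PosSemidef) (p : ℝ) (z : ℂ) :
    Φ (interpPath σ Y p z)ᴴ = (Φ (interpPath σ Y p z))ᴴ :=
  (posSemidef_fromBlocks_map_interpPath hΦ hσ hY p z).fromBlocks_offDiag

lemma trace_sandwich_two_map_interpPath_le (hΦ : IsQuantumChannel Φ) (hσ : σ.PosDef)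
    (hτ : (Φ σ).PosDef) (hY : Y.PosSemidef) {p : ℝ} (hp : p ≠ 0) {z : ℂ} (hz : z.re = 1 / 2) :
    (sandwich 2 (Φ σ) (Φ (interpPath σ Y p z)) *
      (sandwich 2 (Φ σ) (Φ (interpPath σ Y p z)))ᴴ).trace.re ≤ (mpow Y p).trace.re := by
  have h := posSemidef_fromBlocks_map_interpPath hΦ hσ hY p z
  have hw : (1 - z) / 2 + star ((1 - z) / 2) = 1 / 2 := by
    rw [one_sub_div_two_add_star, hz]
    norm_num
  have hM : (mpow Y (p * z.re)).PosSemidef := by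
    have := (posSemidef_fromBlocks_suppPow hY (p * z) 1).fromBlocks_toBlocks₁₁
    simpa using this
  have hMM : mpow Y (p * z.re) * mpow Y (p * z.re) = mpow Y p := by
    have : p * z.re ≠ 0 := by rw [hz]; simpa using hp
    rw [mpow_eq_suppPow hY this, mpow_eq_suppPow hY hp, suppPow_mul hY.1, hz]
    congr 1
    push_cast
    ring
  have hA := hM.mul_mul_conjTranspose_same (suppPow σ ((1 - z) / 2))
  have hD := hM.mul_mul_conjTranspose_same (suppPow σ (star ((1 - z) / 2)))
  rw [suppPow_conjTranspose hσ.1] at hA hD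
  rw [star_star] at hD
  have h1 := trace_sandwich_two_map_sq_le hΦ hσ hτ hA
  have h2 := trace_sandwich_two_map_sq_le hΦ hσ hτ hD
  rw [trace_sandwich_two_sq hσ _ hw, hMM] at h1
  rw [trace_sandwich_two_sq hσ _ (by rw [add_comm, hw]), hMM] at h2
  have h3 := h.fromBlocks_conj (suppPow (Φ σ) (-1 / 4)) (suppPow (Φ σ) (-1 / 4))
  rw [suppPow_conjTranspose hτ.1, star_neg_one_div_four] at h3
  simp only [← sandwich_two hτ] at h3
  have h4 := h3.two_mul_norm_trace_le h3.fromBlocks_swap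
  rw [Complex.add_re, map_interpPath_conjTranspose hΦ hσ hY, ← sandwich_two_conjTranspose hτ] at h4
  linarith [Complex.re_le_norm (sandwich 2 (Φ σ) (Φ (interpPath σ Y p z)) *
      (sandwich 2 (Φ σ) (Φ (interpPath σ Y p z)))ᴴ).trace]

lemma trace_sandwich_two_interpPath_le (hσ : σ.PosDef) (hY : Y.PosSemidef) {p : ℝ} (hp : p ≠ 0)
    {z : ℂ} (hz : z.re = 1 / 2) :
    (sandwich 2 σ (interpPath σ Y p z) * (sandwich 2 σ (interpPath σ Y p z))ᴴ).trace.re ≤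
      (mpow Y p).trace.re :=
  trace_sandwich_two_map_interpPath_le isQuantumChannel_id hσ hσ hY hp hz

lemma dualPath_eq_of_re_eq_half (hσ : σ.PosDef) (hY : Y.PosSemidef) (p : ℝ) {z : ℂ}
    (hz : z.re = 1 / 2) :
    dualPath σ Y p z = suppPow σ (-1 / 2) * (interpPath σ Y p z)ᴴ * suppPow σ (-1 / 2) := by
  have hz' : star z = 1 - z := by
    apply Complex.ext <;> simp [hz]
    norm_num
  have e1 : star ((1 - z) / 2) = z / 2 := by
    rw [star_div₀, star_sub, hz']
    simp
  have e2 : star (p * z) = p * (1 - z) := by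
    rw [star_mul', hz']
    simp
  rw [interpPath, dualPath, Matrix.conjTranspose_mul, Matrix.conjTranspose_mul,
    suppPow_conjTranspose hσ.1, suppPow_conjTranspose hY.1, e1, e2]
  simp only [Matrix.mul_assoc]
  rw [suppPow_mul hσ.1, suppPow_mul_assoc hσ.1]
  congr 3 <;> ring

/-- The Petz recovery map of `Φ` with reference state `σ`. -/
noncomputable def petzMap (Φ : Matrix (Fin n) (Fin n) ℂ →ₗ[ℂ] Matrix (Fin m) (Fin m) ℂ)
    (σ : Matrix (Fin n) (Fin n) ℂ) : Matrix (Fin m) (Fin m) ℂ →ₗ[ℂ] Matrix (Fin n) (Fin n) ℂ :=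
  conjMap (suppPow σ (1 / 2)) ∘ₗ traceAdjoint Φ ∘ₗ conjMap (suppPow (Φ σ) (-1 / 2))

lemma petzMap_apply (hσ : σ.PosDef) (hτ : (Φ σ).PosDef) (X : Matrix (Fin m) (Fin m) ℂ) :
    petzMap Φ σ X = suppPow σ (1 / 2) *
      traceAdjoint Φ (suppPow (Φ σ) (-1 / 2) * X * suppPow (Φ σ) (-1 / 2)) *
        suppPow σ (1 / 2) := by
  have h : petzMap Φ σ X = suppPow σ (1 / 2) *
      traceAdjoint Φ (suppPow (Φ σ) (-1 / 2) * X * (suppPow (Φ σ) (-1 / 2))ᴴ) *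
        (suppPow σ (1 / 2))ᴴ := rfl
  rw [h, suppPow_conjTranspose hσ.1, suppPow_conjTranspose hτ.1]
  simp

lemma petzMap_map (hΦ : IsQuantumChannel Φ) (hσ : σ.PosDef) (hτ : (Φ σ).PosDef) :
    petzMap Φ σ (Φ σ) = σ := by
  have h : suppPow (Φ σ) (-1 / 2) * Φ σ * suppPow (Φ σ) (-1 / 2) = 1 := by
    nth_rewrite 2 [← suppPow_one hτ.posSemidef]
    rw [suppPow_mul hτ.1, suppPow_mul hτ.1]
    norm_num [suppPow_zero hτ]
  rw [petzMap_apply hσ hτ, h, traceAdjoint_one hΦ, Matrix.mul_one, suppPow_mul hσ.1]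
  norm_num [suppPow_one hσ.posSemidef]

lemma isQuantumChannel_petzMap (hΦ : IsQuantumChannel Φ) (hσ : σ.PosDef) (hτ : (Φ σ).PosDef) :
    IsQuantumChannel (petzMap Φ σ) := by
  refine ⟨(isCompletelyPositive_conjMap _).comp
    ((isCompletelyPositive_traceAdjoint hΦ.1).comp (isCompletelyPositive_conjMap _)), fun X => ?_⟩
  have e : (1 / 2 : ℂ) + 1 / 2 = 1 := by norm_num
  rw [petzMap_apply hσ hτ, Matrix.trace_mul_cycle, suppPow_mul hσ.1, e, suppPow_one hσ.posSemidef,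
    Matrix.trace_mul_comm, trace_traceAdjoint_mul]
  nth_rewrite 3 [← suppPow_one hτ.posSemidef]
  rw [Matrix.mul_assoc, suppPow_mul hτ.1, Matrix.trace_mul_cycle, Matrix.trace_mul_comm,
    suppPow_mul hτ.1]
  norm_num [suppPow_zero hτ]

lemma trace_sandwich_two_petzMap_mul (hσ : σ.PosDef) (hτ : (Φ σ).PosDef)
    (X : Matrix (Fin m) (Fin m) ℂ) (Z : Matrix (Fin n) (Fin n) ℂ) :
    (sandwich 2 σ (petzMap Φ σ X) * sandwich 2 σ Z).trace =
      (sandwich 2 (Φ σ) X * sandwich 2 (Φ σ) (Φ Z)).trace := by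
  have e : (1 / 2 : ℂ) + -1 / 2 = 0 := by norm_num
  have e' : (-1 / 2 : ℂ) + 1 / 2 = 0 := by norm_num
  rw [Matrix.trace_mul_comm (sandwich 2 (Φ σ) X), trace_sandwich_two_mul hσ,
    trace_sandwich_two_mul hτ, Matrix.trace_mul_comm (Φ Z), ← trace_traceAdjoint_mul,
    petzMap_apply hσ hτ]
  simp only [Matrix.mul_assoc]
  rw [suppPow_mul_assoc hσ.1, e, suppPow_zero hσ, Matrix.one_mul, Matrix.trace_mul_comm]
  simp only [Matrix.mul_assoc]
  rw [suppPow_mul hσ.1, e', suppPow_zero hσ, Matrix.mul_one]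

/-- In the case of equality in the data processing inequality, the Petz map recovers the
interpolating family on the middle line of the strip. -/
lemma petzMap_map_interpPath_of_re_eq_half {ρ : Matrix (Fin n) (Fin n) ℂ}
    (hΦ : IsQuantumChannel Φ)
    (hσ : σ.PosDef) (hτ : (Φ σ).PosDef) (hρ : ρ.PosSemidef) {p : ℝ} (hp : 1 < p)
    (heq : (mpow (sandwich p σ ρ) p).trace.re = (mpow (sandwich p (Φ σ) (Φ ρ)) p).trace.re)
    {z : ℂ} (hz : z.re = 1 / 2) :
    petzMap Φ σ (Φ (interpPath σ (sandwich p σ ρ) p z)) = interpPath σ (sandwich p σ ρ) p z := by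
  have hY := posSemidef_sandwich hσ hρ p
  have hW := posSemidef_sandwich hτ (hΦ.1.posSemidef hρ) p
  have hp0 : p ≠ 0 := by linarith
  have h := trace_interpPath_mul_dualPath_eq hΦ hσ hτ hρ hp heq (z := z)
    (by rw [hz]; norm_num) (by rw [hz]; norm_num)
  set Y := sandwich p σ ρ
  set W := sandwich p (Φ σ) (Φ ρ)
  have h1 := congrArg Complex.re h
  rw [dualPath_eq_of_re_eq_half hτ hW p hz, ← trace_sandwich_two_mul hτ,
    ← sandwich_two_conjTranspose hτ] at h1
  have h2 : Φ (interpPath σ Y p z) = interpPath (Φ σ) W p z :=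
    sandwich_two_injective hτ <| Matrix.eq_of_trace_mul_conjTranspose
      (heq ▸ trace_sandwich_two_map_interpPath_le hΦ hσ hτ hY hp0 hz)
      (trace_sandwich_two_interpPath_le hτ hW hp0 hz) h1
  have hP := petzMap_map hΦ hσ hτ
  have h3 := trace_sandwich_two_map_interpPath_le (isQuantumChannel_petzMap hΦ hσ hτ) hτ
    (hP.symm ▸ hσ) hW hp0 hz
  rw [hP] at h3
  rw [h2] at h1 ⊢
  refine sandwich_two_injective hσ <| Matrix.eq_of_trace_mul_conjTranspose h3
    (heq ▸ trace_sandwich_two_interpPath_le hσ hY hp0 hz) ?_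
  rw [sandwich_two_conjTranspose hσ, trace_sandwich_two_petzMap_mul hσ hτ,
    map_interpPath_conjTranspose hΦ hσ hY, h2, ← sandwich_two_conjTranspose hτ, h1]

lemma eq_of_eqOn_re_eq_half {f g : ℂ → ℂ} (hf : Differentiable ℂ f) (hg : Differentiable ℂ g)
    (h : ∀ z : ℂ, z.re = 1 / 2 → f z = g z) : f = g := by
  refine AnalyticOnNhd.eq_of_frequently_eq (z₀ := 1 / 2)
    (fun z _ => hf.analyticAt z) (fun z _ => hg.analyticAt z) ?_
  have ht : Filter.Tendsto (fun t : ℝ => (1 / 2 + t * Complex.I : ℂ)) (nhdsWithin 0 {0}ᶜ)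
      (nhdsWithin (1 / 2) {1 / 2}ᶜ) := by
    refine tendsto_nhdsWithin_iff.2 ⟨?_, ?_⟩
    · have : Continuous fun t : ℝ => (1 / 2 + t * Complex.I : ℂ) := by fun_prop
      simpa using (this.tendsto 0).mono_left nhdsWithin_le_nhds
    · filter_upwards [self_mem_nhdsWithin] with t ht
      simpa using ht
  exact ht.frequently (Filter.Eventually.of_forall fun t => h _ (by simp)).frequently

/-- In the case of equality in the data processing inequality, the Petz map recovers the state. -/
lemma petzMap_map_of_trace_eq {ρ : Matrix (Fin n) (Fin n) ℂ} (hΦ : IsQuantumChannel Φ)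
    (hσ : σ.PosDef) (hτ : (Φ σ).PosDef) (hρ : ρ.PosSemidef) {p : ℝ} (hp : 1 < p)
    (heq : (mpow (sandwich p σ ρ) p).trace.re = (mpow (sandwich p (Φ σ) (Φ ρ)) p).trace.re) :
    petzMap Φ σ (Φ ρ) = ρ := by
  have hF := matrixEntireStripBounded_interpPath hσ.1 (posSemidef_sandwich hσ hρ p).1 p
  have hG := (hF.map Φ).map (petzMap Φ σ)
  have h : ∀ z, petzMap Φ σ (Φ (interpPath σ (sandwich p σ ρ) p z)) =
      interpPath σ (sandwich p σ ρ) p z := fun z => by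
    ext i j
    exact congrFun (eq_of_eqOn_re_eq_half (hG i j).1 (hF i j).1 fun w hw =>
      congrFun (congrFun (petzMap_map_interpPath_of_re_eq_half hΦ hσ hτ hρ hp heq hw) i) j) z
  have := h (1 / p)
  rwa [interpPath_sandwich hσ hρ hp] at this

lemma sandwich_ne_zero {ρ : Matrix (Fin n) (Fin n) ℂ} (hσ : σ.PosDef) (hρ : ρ ≠ 0) (p : ℝ) :
    sandwich p σ ρ ≠ 0 := by
  intro h
  refine hρ ?_
  have h1 : suppPow σ (-((1 - p) / (2 * p) : ℝ)) * sandwich p σ ρ *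
      suppPow σ (-((1 - p) / (2 * p) : ℝ)) = ρ := by
    rw [sandwich_eq hσ]
    simp only [Matrix.mul_assoc]
    rw [suppPow_mul hσ.1, suppPow_mul_assoc hσ.1, neg_add_cancel, add_neg_cancel, suppPow_zero hσ,
      Matrix.one_mul, Matrix.mul_one]
  rw [← h1, h, Matrix.mul_zero, Matrix.zero_mul]

end petz

theorem equality_in_DPI_iff_sufficient_of_one_lt {n m : ℕ}
    (Φ : Matrix (Fin n) (Fin n) ℂ →ₗ[ℂ] Matrix (Fin m) (Fin m) ℂ)
    (hΦ : IsQuantumChannel Φ)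
    (ψ φ : Matrix (Fin n) (Fin n) ℂ)
    (hψ : ψ.PosSemidef) (hψ1 : ψ.trace = 1) (hφ : φ.PosDef) (hΦφ : (Φ φ).PosDef)
    (α : ℝ) (hα : 1 < α) :
    sandwichedRenyi α ψ φ = sandwichedRenyi α (Φ ψ) (Φ φ) ↔
      ∃ Ψ : Matrix (Fin m) (Fin m) ℂ →ₗ[ℂ] Matrix (Fin n) (Fin n) ℂ,
        IsQuantumChannel Ψ ∧ Ψ (Φ ψ) = ψ ∧ Ψ (Φ φ) = φ := by
  have hΦψ := hΦ.1.posSemidef hψ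
  have h0 : ψ ≠ 0 := by
    rintro rfl
    simp at hψ1
  have h0' : Φ ψ ≠ 0 := fun h => by
    have := hΦ.2 ψ
    rw [h, hψ1] at this
    simp at this
  have hD : ∀ {k : ℕ} (ρ σ : Matrix (Fin k) (Fin k) ℂ), sandwichedRenyi α ρ σ =
    1 / (α - 1) * Real.log (mpow (sandwich α σ ρ) α).trace.re := fun _ _ => rfl
  rw [hD, hD]
  constructor
  · intro h
    have h1 := mul_left_cancel₀ (one_div_ne_zero (sub_ne_zero.2 hα.ne')) h
    have h2 := Real.log_injOn_pos
      (trace_mpow_re_pos (posSemidef_sandwich hφ hψ α) (sandwich_ne_zero hφ h0 α) α)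
      (trace_mpow_re_pos (posSemidef_sandwich hΦφ hΦψ α) (sandwich_ne_zero hΦφ h0' α) α) h1
    exact ⟨petzMap Φ φ, isQuantumChannel_petzMap hΦ hφ hΦφ,
      petzMap_map_of_trace_eq hΦ hφ hΦφ hψ hα h2, petzMap_map hΦ hφ hΦφ⟩
  · rintro ⟨Ψ, hΨ, h1, h2⟩
    have h3 := trace_mpow_sandwich_le hΨ hΦφ (h2.symm ▸ hφ) hΦψ hα
    rw [h1, h2] at h3
    rw [le_antisymm h3 (trace_mpow_sandwich_le hΦ hφ hΦφ hψ hα)]
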